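/- There is no direct junction between a nonsaturating singular arc of order two and a regular arc along which the control has a limit at the junction. Precisely: let τ ∈ ℝ, ε > 0, and let h = (h1, h2) : (τ−ε, τ+ε) → ℝ² be of class C³ and four times differentiable on (τ, τ+ε), with h(t) = (0,0) for all t ∈ (τ−ε, τ] and h(t) ≠ (0,0) for all t ∈ (τ, τ+ε); define u(t) = h(t)/‖h(t)‖ for t ∈ (τ, τ+ε). Assume there exist functions a10, a20, a11, a22 : (τ−ε, τ+ε) → ℝ, continuous at τ, with a11(τ) < 0 and a22(τ) < 0, such that hₖ⁗(t) = a_{k0}(t) + u_k(t)·a_{kk}(t) for all t ∈ (τ, τ+ε) and k = 1,2; assume there exists u_s = (u_{s1}, u_{s2}) ∈ ℝ² with ‖u_s‖ < 1 and a_{k0}(τ) + u_{sk}·a_{kk}(τ) = 0 for k = 1,2; and assume that u(t) converges as t → τ⁺. Then these assumptions are contradictory (they imply False); consequently, connecting a singular arc of order two, on which the singular control does not saturate the constraint, with a regular arc forces the optimal control to switch infinitely many times near the junction (chattering). -/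

import Mathlib

open Set Filter Topology

/-- If a function vanishes to the left of `τ` up to `τ`, so does its derivative. -/
lemma deriv_eq_zero_of_eq_zero_Ioc {f : ℝ → ℝ} {a τ : ℝ}
    (hd : ∀ t ∈ Ioc a τ, DifferentiableAt ℝ f t) (h0 : ∀ t ∈ Ioc a τ, f t = 0) :
    ∀ t ∈ Ioc a τ, deriv f t = 0 := by
  intro t ht
  have hu : UniqueDiffWithinAt ℝ (Ioc a τ) t := uniqueDiffOn_Ioc a τ t ht
  have hz : HasDerivWithinAt f 0 (Ioc a τ) t :=
    (hasDerivWithinAt_const t (Ioc a τ) (0 : ℝ)).congr h0 (h0 t ht)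
  exact hu.eq_deriv _ (hd t ht).hasDerivAt.hasDerivWithinAt hz

lemma neg_of_deriv_neg_of_eq_zero {f : ℝ → ℝ} {τ b : ℝ}
    (hc : ContinuousOn f (Ico τ b)) (h0 : f τ = 0)
    (hd : ∀ t ∈ Ioo τ b, deriv f t < 0) : ∀ t ∈ Ioo τ b, f t < 0 := by
  intro t ht
  have hanti : StrictAntiOn f (Ico τ b) :=
    strictAntiOn_of_deriv_neg (convex_Ico τ b) hc (by simpa using hd)
  simpa [h0] using
    hanti ⟨le_rfl, ht.1.trans ht.2⟩ ⟨ht.1.le, ht.2⟩ ht.1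

/-- A `C^n` function vanishing to the left of `τ` is negative to the right of `τ` as soon as its
derivative of order `n + 1` is. -/
lemma neg_of_iterate_deriv_neg {a τ b c : ℝ} (haτ : a < τ) (hbc : b ≤ c) (n : ℕ) :
    ∀ {f : ℝ → ℝ}, ContDiffOn ℝ n f (Ioo a c) → (∀ t ∈ Ioc a τ, f t = 0) →
      (∀ t ∈ Ioo τ b, deriv^[n + 1] f t < 0) → ∀ t ∈ Ioo τ b, f t < 0 := by
  induction n with
  | zero =>
    intro f hf h0 hd
    exact neg_of_deriv_neg_of_eq_zero
      (hf.continuousOn.mono fun t ht => ⟨haτ.trans_le ht.1, ht.2.trans_le hbc⟩)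
      (h0 τ ⟨haτ, le_rfl⟩) hd
  | succ n ih =>
    intro f hf h0 hd t ht
    have hτc : τ < c := (ht.1.trans ht.2).trans_le hbc
    have hdiff : ∀ s ∈ Ioc a τ, DifferentiableAt ℝ f s := fun s hs =>
      (hf.differentiableOn (by simp)).differentiableAt
        (Ioo_mem_nhds hs.1 (hs.2.trans_lt hτc))
    refine neg_of_deriv_neg_of_eq_zero
      (hf.continuousOn.mono fun t ht => ⟨haτ.trans_le ht.1, ht.2.trans_le hbc⟩)
      (h0 τ ⟨haτ, le_rfl⟩) ?_ t ht
    exact ih (hf.deriv_of_isOpen isOpen_Ioo (by norm_cast))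
      (deriv_eq_zero_of_eq_zero_Ioc hdiff h0) hd

/-- At a junction with a positive limit control, the singular control is at least the limit. -/
lemma limit_control_le_singular_control {τ ε L us : ℝ} (hε : 0 < ε) {h r a0 a1 u : ℝ → ℝ}
    (hC : ContDiffOn ℝ 3 h (Ioo (τ - ε) (τ + ε)))
    (h0 : ∀ t ∈ Ioc (τ - ε) τ, h t = 0) (hr : ∀ t, 0 ≤ r t)
    (hu : ∀ t ∈ Ioo τ (τ + ε), u t = h t / r t)
    (ha0 : ContinuousAt a0 τ) (ha1 : ContinuousAt a1 τ) (hneg : a1 τ < 0)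
    (heq : ∀ t ∈ Ioo τ (τ + ε), deriv^[4] h t = a0 t + u t * a1 t)
    (hs : a0 τ + us * a1 τ = 0) (hconv : Tendsto u (𝓝[>] τ) (𝓝 L)) (hL : 0 < L) :
    L ≤ us := by
  by_contra! hlt
  have hlim : Tendsto (fun t => a0 t + u t * a1 t) (𝓝[>] τ) (𝓝 (a0 τ + L * a1 τ)) :=
    (ha0.mono_left nhdsWithin_le_nhds).add (hconv.mul (ha1.mono_left nhdsWithin_le_nhds))
  have hev : ∀ᶠ t in 𝓝[>] τ, a0 t + u t * a1 t < 0 ∧ 0 < u t ∧ t < τ + ε :=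
    (hlim.eventually_lt_const (by nlinarith)).and
      ((hconv.eventually_const_lt hL).and
        (eventually_nhdsWithin_of_eventually_nhds (eventually_lt_nhds (by linarith))))
  obtain ⟨b, hb, hsub⟩ := (mem_nhdsGT_iff_exists_Ioo_subset).1 hev
  have hb : τ < b := hb
  have hmem : ∀ t ∈ Ioo τ (min b (τ + ε)), t ∈ Ioo τ b ∧ t ∈ Ioo τ (τ + ε) := fun t ht =>
    ⟨⟨ht.1, ht.2.trans_le (min_le_left _ _)⟩, ⟨ht.1, ht.2.trans_le (min_le_right _ _)⟩⟩
  have hhneg := neg_of_iterate_deriv_neg (by linarith) (min_le_right b (τ + ε)) 3 hC h0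
    fun t ht => (heq t (hmem t ht).2).trans_lt (hsub (hmem t ht).1).1
  obtain ⟨t, ht⟩ : (Ioo τ (min b (τ + ε))).Nonempty :=
    nonempty_Ioo.2 (lt_min hb (by linarith))
  have hpos := (hsub (hmem t ht).1).2.1
  rw [hu t (hmem t ht).2] at hpos
  exact hpos.not_ge (div_nonpos_of_nonpos_of_nonneg (hhneg t ht).le (hr t))

/-- At a junction, the singular control is at least as large in magnitude as the limit control. -/
lemma limit_control_sq_le_singular_control_sq {τ ε L us : ℝ} (hε : 0 < ε)
    {h r a0 a1 u : ℝ → ℝ} (hC : ContDiffOn ℝ 3 h (Ioo (τ - ε) (τ + ε)))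
    (h0 : ∀ t ∈ Ioc (τ - ε) τ, h t = 0) (hr : ∀ t, 0 ≤ r t)
    (hu : ∀ t ∈ Ioo τ (τ + ε), u t = h t / r t)
    (ha0 : ContinuousAt a0 τ) (ha1 : ContinuousAt a1 τ) (hneg : a1 τ < 0)
    (heq : ∀ t ∈ Ioo τ (τ + ε), deriv^[4] h t = a0 t + u t * a1 t)
    (hs : a0 τ + us * a1 τ = 0) (hconv : Tendsto u (𝓝[>] τ) (𝓝 L)) :
    L ^ 2 ≤ us ^ 2 := by
  rcases lt_trichotomy L 0 with hL | rfl | hL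
  · have := limit_control_le_singular_control (h := -h) (r := r) (a0 := -a0) (a1 := a1)
      (u := -u) (L := -L) (us := -us) hε hC.neg (fun t ht => by simp [h0 t ht]) hr
      (fun t ht => by simp [hu t ht, neg_div]) ha0.neg ha1 hneg
      (fun t ht => by
        have := heq t ht
        rw [← iteratedDeriv_eq_iterate] at this ⊢
        rw [iteratedDeriv_neg, this]
        simp only [Pi.neg_apply]
        ring)
      (by simp only [Pi.neg_apply]; linarith) hconv.neg (by linarith)
    nlinarith
  · simpa using sq_nonneg us
  · have := limit_control_le_singular_control hε hC h0 hr hu ha0 ha1 hneg heq hs hconv hL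
    nlinarith


/- STATEMENT 0: No direct junction between a nonsaturating singular arc of order two
and a regular arc along which the control has a limit at the junction. -/
theorem no_singular_regular_junction
    (τ ε : ℝ) (hε : 0 < ε)
    (h1 h2 a10 a20 a11 a22 u1 u2 : ℝ → ℝ)
    -- h = (h1, h2) is of class C³ on (τ-ε, τ+ε)
    (hC3₁ : ContDiffOn ℝ 3 h1 (Set.Ioo (τ - ε) (τ + ε)))
    (hC3₂ : ContDiffOn ℝ 3 h2 (Set.Ioo (τ - ε) (τ + ε)))
    -- and four times differentiable on (τ, τ+ε)
    (hd4₁ : ∀ t ∈ Set.Ioo τ (τ + ε), DifferentiableAt ℝ (deriv^[3] h1) t)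
    (hd4₂ : ∀ t ∈ Set.Ioo τ (τ + ε), DifferentiableAt ℝ (deriv^[3] h2) t)
    -- h ≡ (0,0) on (τ-ε, τ]  (singular side)
    (hsing : ∀ t ∈ Set.Ioc (τ - ε) τ, h1 t = 0 ∧ h2 t = 0)
    -- h ≠ (0,0) on (τ, τ+ε)  (regular side)
    (hreg : ∀ t ∈ Set.Ioo τ (τ + ε), (h1 t, h2 t) ≠ (0, 0))
    -- u = h / ‖h‖ on the regular side
    (hu1 : ∀ t ∈ Set.Ioo τ (τ + ε), u1 t = h1 t / Real.sqrt ((h1 t) ^ 2 + (h2 t) ^ 2))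
    (hu2 : ∀ t ∈ Set.Ioo τ (τ + ε), u2 t = h2 t / Real.sqrt ((h1 t) ^ 2 + (h2 t) ^ 2))
    -- the coefficient functions are continuous at τ
    (ha10 : ContinuousAt a10 τ) (ha20 : ContinuousAt a20 τ)
    (ha11 : ContinuousAt a11 τ) (ha22 : ContinuousAt a22 τ)
    -- strengthened generalized Legendre-Clebsch condition
    (ha11neg : a11 τ < 0) (ha22neg : a22 τ < 0)
    -- form of the fourth derivative of the switching function on the regular side
    (heq1 : ∀ t ∈ Set.Ioo τ (τ + ε), deriv^[4] h1 t = a10 t + u1 t * a11 t)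
    (heq2 : ∀ t ∈ Set.Ioo τ (τ + ε), deriv^[4] h2 t = a20 t + u2 t * a22 t)
    -- nonsaturating singular control u_s at τ
    (us1 us2 : ℝ) (hus : Real.sqrt (us1 ^ 2 + us2 ^ 2) < 1)
    (hs1 : a10 τ + us1 * a11 τ = 0) (hs2 : a20 τ + us2 * a22 τ = 0)
    -- the regular control converges at the junction
    (L1 L2 : ℝ)
    (hconv : Filter.Tendsto (fun t => (u1 t, u2 t)) (nhdsWithin τ (Set.Ioi τ))
      (nhds (L1, L2))) :
    False := by
  have hc1 : Filter.Tendsto u1 (𝓝[>] τ) (𝓝 L1) := hconv.fst_nhds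
  have hc2 : Filter.Tendsto u2 (𝓝[>] τ) (𝓝 L2) := hconv.snd_nhds
  have hnorm : ∀ᶠ t in 𝓝[>] τ, u1 t ^ 2 + u2 t ^ 2 = 1 := by
    filter_upwards [Ioo_mem_nhdsGT (show τ < τ + ε by linarith)] with t ht
    have hpos : 0 < h1 t ^ 2 + h2 t ^ 2 := by
      by_contra! hle
      refine hreg t ht (Prod.ext ?_ ?_)
      · exact pow_eq_zero_iff two_ne_zero |>.1 (by nlinarith [sq_nonneg (h1 t), sq_nonneg (h2 t)])
      · exact pow_eq_zero_iff two_ne_zero |>.1 (by nlinarith [sq_nonneg (h1 t), sq_nonneg (h2 t)])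
    rw [hu1 t ht, hu2 t ht, div_pow, div_pow, Real.sq_sqrt hpos.le, ← add_div,
      div_self hpos.ne']
  have hL : L1 ^ 2 + L2 ^ 2 = 1 :=
    tendsto_nhds_unique_of_eventuallyEq ((hc1.pow 2).add (hc2.pow 2)) tendsto_const_nhds hnorm
  have hle1 := limit_control_sq_le_singular_control_sq hε hC3₁ (fun t ht => (hsing t ht).1)
    (fun _ => Real.sqrt_nonneg _) hu1 ha10 ha11 ha11neg heq1 hs1 hc1
  have hle2 := limit_control_sq_le_singular_control_sq hε hC3₂ (fun t ht => (hsing t ht).2)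
    (fun _ => Real.sqrt_nonneg _) hu2 ha20 ha22 ha22neg heq2 hs2 hc2
  rw [Real.sqrt_lt' one_pos] at hus
  linarith
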